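/- For all M₀ > 0 and C > 0, there exist A > 0 and h₀ > 0 such that for all h ∈ (0, h₀], all integers N ≥ 1 with Nh ≤ M₀, all z ∈ ℂ with dist(z, { μ_α : α ∈ ℕⁿ }) ≥ 1/C, and every polynomial u on ℂⁿ of degree < N, one has ‖u‖_{H_Φ} ≤ A e^{A/h} ‖(z − Q_h)u‖_{H_Φ}. -/

import Mathlib

open MeasureTheory

/-- The squared Euclidean norm `|x|² = Σ |x_j|²` on ℂⁿ. -/
noncomputable def eNormSq {n : ℕ} (x : Fin n → ℂ) : ℝ := ∑ j, Complex.normSq (x j)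

/-- The weighted norm `‖u‖_{H_Φ}` with `Φ(x) = |x|²/2`:
`‖u‖²_{H_Φ} = ∫_{ℂⁿ} |u(x)|² e^{−|x|²/h} L(dx)`. -/
noncomputable def hPhiNorm {n : ℕ} (h : ℝ) (f : (Fin n → ℂ) → ℂ) : ℝ :=
  Real.sqrt (∫ x : Fin n → ℂ, ‖f x‖ ^ 2 * Real.exp (-eNormSq x / h))

/-- Evaluation of a polynomial on ℂⁿ as a function. -/
noncomputable def evalPoly {n : ℕ} (u : MvPolynomial (Fin n) ℂ)
    (x : Fin n → ℂ) : ℂ :=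
  MvPolynomial.eval x u

/-- The operator
`Q_h u = (h/i)[Σ_j 2λ_j x_j ∂u/∂x_j + Σ_{j+1<n} γ_j x_{j+1} ∂u/∂x_j + (Σ_j λ_j) u]`
acting on polynomials on ℂⁿ. -/
noncomputable def qOp (n : ℕ) (lam γ : Fin n → ℂ) (h : ℝ)
    (u : MvPolynomial (Fin n) ℂ) : MvPolynomial (Fin n) ℂ :=
  MvPolynomial.C ((h : ℂ) / Complex.I) *
    ((∑ j : Fin n, MvPolynomial.C (2 * lam j) * MvPolynomial.X j * MvPolynomial.pderiv j u)
      + (∑ j : Fin n, if hj : (j : ℕ) + 1 < n then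
            MvPolynomial.C (γ j) * MvPolynomial.X (⟨(j : ℕ) + 1, hj⟩ : Fin n)
              * MvPolynomial.pderiv j u
          else 0)
      + MvPolynomial.C (∑ j, lam j) * u)

/-- The set of eigenvalues `μ_α = (h/i) Σ_j λ_j(2α_j+1)`, `α ∈ ℕⁿ`, of `Q_h`. -/
noncomputable def specQ (n : ℕ) (lam : Fin n → ℂ) (h : ℝ) : Set ℂ :=
  {w | ∃ α : Fin n → ℕ, w = (h : ℂ) / Complex.I * ∑ j, lam j * (2 * (α j : ℂ) + 1)}

/-- The one-dimensional Gaussian monomial. -/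
noncomputable def gmon (h : ℝ) (a b : ℕ) (z : ℂ) : ℂ :=
  z ^ a * (starRingEnd ℂ z) ^ b * ((Real.exp (-Complex.normSq z / h) : ℝ) : ℂ)

/-- Squared norm of `x^α`. -/
noncomputable def fw {n : ℕ} (h : ℝ) (α : Fin n → ℕ) : ℝ :=
  ∏ j, (Real.pi * h ^ (α j + 1) * (α j).factorial)

lemma fw_pos {n : ℕ} {h : ℝ} (hh : 0 < h) (α : Fin n → ℕ) : 0 < fw h α := by
  unfold fw
  apply Finset.prod_pos
  intro j _
  have := Real.pi_pos
  positivity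

lemma gmon_norm_integral {h : ℝ} (hh : 0 < h) (m : ℕ) :
    ∫ z : ℂ, ‖z‖ ^ m * Real.exp (-Complex.normSq z / h) =
      Real.pi * (1 / h) ^ (-((m : ℝ) + 2) / 2) * Real.Gamma (((m : ℝ) + 2) / 2) := by
  have := Complex.integral_rpow_mul_exp_neg_mul_rpow (p := 2) (q := m) (b := 1 / h)
    (by norm_num) (by have : (0 : ℝ) ≤ m := Nat.cast_nonneg m
                      linarith) (by positivity)
  rw [show 2 * Real.pi / 2 = Real.pi by ring] at this
  rw [← this]
  congr 1
  ext z
  rw [Real.rpow_natCast, Complex.normSq_eq_norm_sq]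
  congr 2
  rw [show (2 : ℝ) = ((2 : ℕ) : ℝ) by norm_num, Real.rpow_natCast]
  ring

lemma gmon_cont (h : ℝ) (a b : ℕ) : Continuous (gmon h a b) := by
  unfold gmon
  have := Complex.continuous_normSq
  have := Complex.continuous_conj
  fun_prop

lemma gmon_integrable {h : ℝ} (hh : 0 < h) (a b : ℕ) : Integrable (gmon h a b) := by
  have h1 : Integrable (fun z : ℂ => ‖z‖ ^ (a + b) * Real.exp (-Complex.normSq z / h)) := by
    apply Integrable.of_integral_ne_zero
    rw [gmon_norm_integral hh]
    have := Real.pi_pos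
    have := Real.Gamma_pos_of_pos (s := (((a + b : ℕ) : ℝ) + 2) / 2) (by positivity)
    positivity
  refine h1.mono' (gmon_cont h a b).aestronglyMeasurable (Filter.Eventually.of_forall fun z => ?_)
  unfold gmon
  rw [norm_mul, norm_mul, norm_pow, norm_pow, RCLike.norm_conj, Complex.norm_real,
    Real.norm_of_nonneg (Real.exp_pos _).le, pow_add]

lemma gmon_integral_self {h : ℝ} (hh : 0 < h) (a : ℕ) :
    ∫ z, gmon h a a z = ((Real.pi * h ^ (a + 1) * a.factorial : ℝ) : ℂ) := by
  have h1 : ∀ z, gmon h a a z = ((‖z‖ ^ (2 * a) * Real.exp (-Complex.normSq z / h) : ℝ) : ℂ) := by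
    intro z
    unfold gmon
    rw [← mul_pow, Complex.mul_conj, Complex.normSq_eq_norm_sq, pow_mul]
    push_cast
    rfl
  simp_rw [h1]
  rw [integral_complex_ofReal, gmon_norm_integral hh]
  congr 1
  have e1 : (((2 * a : ℕ) : ℝ) + 2) / 2 = (a : ℝ) + 1 := by push_cast; ring
  have e2 : -(((2 * a : ℕ) : ℝ) + 2) / 2 = -((a + 1 : ℕ) : ℝ) := by push_cast; ring
  rw [e1, e2, Real.Gamma_nat_eq_factorial, Real.rpow_neg (by positivity), Real.rpow_natCast]
  simp

lemma gmon_integral_ne (h : ℝ) {a b : ℕ} (hab : a ≠ b) :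
    ∫ z, gmon h a b z = 0 := by
  have hne : ((a : ℝ) - b) ≠ 0 := sub_ne_zero.mpr (by exact_mod_cast hab)
  have hneC : ((a : ℂ) - b) ≠ 0 := by exact_mod_cast hne
  set c : Circle := Circle.exp (Real.pi / ((a : ℝ) - b)) with hc
  have hmp := (LinearIsometryEquiv.measurePreserving (rotation c)).integral_comp
    (rotation c).toHomeomorph.measurableEmbedding (gmon h a b)
  have h1 : ∀ z, gmon h a b (rotation c z) = - gmon h a b z := by
    intro z
    unfold gmon
    rw [rotation_apply, map_mul, map_mul, Complex.normSq_eq_norm_sq (c : ℂ)]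
    have : (c : ℂ) ^ a * (starRingEnd ℂ (c : ℂ)) ^ b = -1 := by
      rw [hc, Circle.coe_exp, ← Complex.exp_conj, ← Complex.exp_nat_mul, ← Complex.exp_nat_mul,
        ← Complex.exp_add]
      rw [← Complex.exp_pi_mul_I]
      congr 1
      simp only [map_mul, Complex.conj_ofReal, Complex.conj_I]
      push_cast
      field_simp
      ring
    rw [mul_pow, mul_pow]
    simp only [Circle.norm_coe, one_pow, one_mul]
    linear_combination (z ^ a * (starRingEnd ℂ z) ^ b *
      ((Real.exp (-Complex.normSq z / h) : ℝ) : ℂ)) * this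
  simp_rw [h1] at hmp
  rw [integral_neg] at hmp
  exact self_eq_neg.mp hmp.symm

lemma hPhi_sq {n : ℕ} {h : ℝ} (hh : 0 < h) (u : MvPolynomial (Fin n) ℂ) :
    ∫ x : Fin n → ℂ, ‖evalPoly u x‖ ^ 2 * Real.exp (-eNormSq x / h) =
      ∑ α ∈ u.support, ‖u.coeff α‖ ^ 2 * fw h α := by
  have h1 : ∀ x : Fin n → ℂ,
      ((‖evalPoly u x‖ ^ 2 * Real.exp (-eNormSq x / h) : ℝ) : ℂ) =
      ∑ α ∈ u.support, ∑ β ∈ u.support, (u.coeff α * starRingEnd ℂ (u.coeff β)) *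
        ∏ j, gmon h (α j) (β j) (x j) := by
    intro x
    have e : Real.exp (-eNormSq x / h) = ∏ j, Real.exp (-Complex.normSq (x j) / h) := by
      rw [← Real.exp_sum]
      congr 1
      unfold eNormSq
      rw [← Finset.sum_neg_distrib, Finset.sum_div]
    rw [e]
    push_cast
    rw [← Complex.mul_conj']
    unfold evalPoly
    rw [MvPolynomial.eval_eq', map_sum, Finset.sum_mul_sum, Finset.sum_mul]
    refine Finset.sum_congr rfl fun α _ => ?_
    rw [Finset.sum_mul]
    refine Finset.sum_congr rfl fun β _ => ?_
    unfold gmon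
    rw [Finset.prod_mul_distrib, Finset.prod_mul_distrib, map_mul, map_prod]
    simp only [map_pow]
    push_cast
    ring
  have hint : ∀ α β : Fin n → ℕ, Integrable (fun x : Fin n → ℂ => ∏ j, gmon h (α j) (β j) (x j)) :=
    fun α β => Integrable.fintype_prod (f := fun j => gmon h (α j) (β j))
      fun j => gmon_integrable hh _ _
  have h2 : ((∫ x : Fin n → ℂ, ‖evalPoly u x‖ ^ 2 * Real.exp (-eNormSq x / h) : ℝ) : ℂ) =
      ((∑ α ∈ u.support, ‖u.coeff α‖ ^ 2 * fw h α : ℝ) : ℂ) := by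
    rw [← integral_complex_ofReal]
    simp_rw [h1]
    rw [integral_finsetSum u.support (fun (α : Fin n →₀ ℕ) _ => integrable_finsetSum u.support
      (fun (β : Fin n →₀ ℕ) _ => (hint α β).const_mul
        (u.coeff α * starRingEnd ℂ (u.coeff β))))]
    rw [Complex.ofReal_sum]
    refine Finset.sum_congr rfl fun α hα => ?_
    rw [integral_finsetSum u.support (fun (β : Fin n →₀ ℕ) _ => (hint α β).const_mul
      (u.coeff α * starRingEnd ℂ (u.coeff β)))]
    rw [Finset.sum_eq_single α]
    · rw [integral_const_mul, integral_fintype_prod_volume_eq_prod]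
      simp_rw [gmon_integral_self hh]
      rw [Complex.mul_conj']
      unfold fw
      push_cast
      rfl
    · intro β _ hβ
      rw [integral_const_mul, integral_fintype_prod_volume_eq_prod]
      obtain ⟨j, hj⟩ : ∃ j, α j ≠ β j := by
        by_contra hcon
        push Not at hcon
        exact hβ (Finsupp.ext hcon).symm
      rw [Finset.prod_eq_zero (Finset.mem_univ j) (gmon_integral_ne h hj), mul_zero]
    · intro hcon
      exact absurd hα hcon
  exact_mod_cast h2

/-- The grading weight. -/
def wt {n : ℕ} (α : Fin n → ℕ) : ℕ := ∑ j : Fin n, (j : ℕ) * α j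

/-- The rescaled coefficient weight. -/
noncomputable def sw {n : ℕ} (t h : ℝ) (α : Fin n → ℕ) : ℝ := t ^ wt α * Real.sqrt (fw h α)

lemma sw_pos {n : ℕ} {t h : ℝ} (ht : 0 < t) (hh : 0 < h) (α : Fin n → ℕ) : 0 < sw t h α := by
  unfold sw
  have := Real.sqrt_pos.mpr (fw_pos hh α)
  positivity

lemma wt_add_single {n : ℕ} (δ : Fin n →₀ ℕ) (i : Fin n) :
    wt (δ + Finsupp.single i 1 : Fin n →₀ ℕ) = wt δ + i := by
  unfold wt
  simp [mul_add, Finset.sum_add_distrib, Finsupp.single_apply]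

lemma fw_add_single {n : ℕ} (h : ℝ) (δ : Fin n →₀ ℕ) (i : Fin n) :
    fw h (δ + Finsupp.single i 1 : Fin n →₀ ℕ) = fw h δ * (h * ((δ i : ℝ) + 1)) := by
  classical
  unfold fw
  rw [← Finset.mul_prod_erase _ _ (Finset.mem_univ i)]
  conv_rhs => rw [← Finset.mul_prod_erase _ _ (Finset.mem_univ i)]
  have : ∀ j ∈ Finset.univ.erase i,
      Real.pi * h ^ ((δ + Finsupp.single i 1 : Fin n →₀ ℕ) j + 1) *
        (((δ + Finsupp.single i 1 : Fin n →₀ ℕ) j).factorial : ℝ) =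
      Real.pi * h ^ (δ j + 1) * ((δ j).factorial : ℝ) := by
    intro j hj
    have hj : i ≠ j := (Finset.ne_of_mem_erase hj).symm
    simp [Finsupp.single_apply, hj]
  rw [Finset.prod_congr rfl this]
  simp only [Finsupp.add_apply, Finsupp.single_eq_same, Nat.factorial_succ]
  push_cast
  ring

lemma deg_lt {n N : ℕ} {u : MvPolynomial (Fin n) ℂ} (hu : u.totalDegree < N) {β : Fin n →₀ ℕ}
    (hβ : u.coeff β ≠ 0) : ∑ i, β i < N := by
  have := MvPolynomial.le_totalDegree (MvPolynomial.mem_support_iff.mpr hβ)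
  rw [Finsupp.sum_fintype _ _ (fun _ => rfl)] at this
  omega

lemma shift_bound {n N : ℕ} {t h m : ℝ} (ht : 0 < t) (hh : 0 < h) (hm : 0 ≤ m)
    {u : MvPolynomial (Fin n) ℂ} (hu : u.totalDegree < N)
    (hmax : ∀ β : Fin n →₀ ℕ, ‖u.coeff β‖ * sw t h β ≤ m)
    (j k : Fin n) (hk : (k : ℕ) = j + 1) (α : Fin n →₀ ℕ) :
    ‖(MvPolynomial.X k * MvPolynomial.pderiv j u).coeff α‖ * sw t h α ≤ t * N * m := by
  classical
  have hR : 0 ≤ t * N * m := by positivity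
  rw [MvPolynomial.coeff_X_mul']
  split_ifs with hs
  swap
  · simpa using hR
  obtain ⟨δ, rfl⟩ : ∃ δ : Fin n →₀ ℕ, α = δ + Finsupp.single k 1 := by
    refine ⟨α - Finsupp.single k 1, (tsub_add_cancel_of_le ?_).symm⟩
    rw [Finsupp.single_le_iff]
    have := Finsupp.mem_support_iff.mp hs
    omega
  rw [add_tsub_cancel_right, MvPolynomial.coeff_pderiv]
  by_cases hz : u.coeff (δ + Finsupp.single j 1) = 0
  · rw [hz]
    simpa using hR
  have hd := deg_lt hu hz
  have hsum : ∑ i, (δ + Finsupp.single j 1 : Fin n →₀ ℕ) i = ∑ i, δ i + 1 := by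
    simp [Finset.sum_add_distrib, Finsupp.single_apply]
  rw [hsum] at hd
  have hb : ∀ i, (δ i : ℝ) + 1 ≤ N := by
    intro i
    have := Finset.single_le_sum (f := fun i => δ i) (fun _ _ => Nat.zero_le _) (Finset.mem_univ i)
    have h2 : δ i + 1 ≤ N := by omega
    exact_mod_cast h2
  have hswle : ((δ j : ℝ) + 1) * sw t h (δ + Finsupp.single k 1 : Fin n →₀ ℕ) ≤
      t * N * sw t h (δ + Finsupp.single j 1 : Fin n →₀ ℕ) := by
    unfold sw
    rw [wt_add_single, wt_add_single, fw_add_single, fw_add_single, hk, ← mul_assoc (fw h δ),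
      ← mul_assoc (fw h δ)]
    have hF : 0 ≤ fw h δ * h := (mul_pos (fw_pos hh _) hh).le
    rw [Real.sqrt_mul hF, Real.sqrt_mul hF]
    have hj0 : (0 : ℝ) ≤ (δ j : ℝ) + 1 := by positivity
    have hN0 : (0 : ℝ) ≤ N := Nat.cast_nonneg N
    have key : ((δ j : ℝ) + 1) * Real.sqrt ((δ k : ℝ) + 1) ≤ N * Real.sqrt ((δ j : ℝ) + 1) := by
      have e1 := Real.mul_self_sqrt hj0
      have e2 := Real.mul_self_sqrt hN0
      have l1 := Real.sqrt_le_sqrt (hb j)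
      have l2 := Real.sqrt_le_sqrt (hb k)
      calc ((δ j : ℝ) + 1) * Real.sqrt ((δ k : ℝ) + 1)
          = Real.sqrt ((δ j : ℝ) + 1) * (Real.sqrt ((δ j : ℝ) + 1) * Real.sqrt ((δ k : ℝ) + 1)) := by
            rw [← mul_assoc, e1]
        _ ≤ Real.sqrt ((δ j : ℝ) + 1) * (Real.sqrt N * Real.sqrt N) := by gcongr
        _ = N * Real.sqrt ((δ j : ℝ) + 1) := by rw [e2]; ring
    have hP : 0 ≤ t ^ (wt δ + (j + 1)) * Real.sqrt (fw h δ * h) := by positivity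
    have := mul_le_mul_of_nonneg_left key hP
    calc _ = t ^ (wt δ + (j + 1)) * Real.sqrt (fw h δ * h) *
          (((δ j : ℝ) + 1) * Real.sqrt ((δ k : ℝ) + 1)) := by ring
      _ ≤ _ := this
      _ = _ := by ring
  have hnorm : ‖((δ j : ℂ) + 1)‖ = (δ j : ℝ) + 1 := by
    rw [show ((δ j : ℂ) + 1) = ((δ j + 1 : ℕ) : ℂ) by push_cast; rfl, Complex.norm_natCast]
    push_cast; rfl
  rw [norm_mul, hnorm, mul_assoc]
  calc _ ≤ ‖u.coeff (δ + Finsupp.single j 1)‖ *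
        (t * N * sw t h (δ + Finsupp.single j 1 : Fin n →₀ ℕ)) := by gcongr
    _ = t * N * (‖u.coeff (δ + Finsupp.single j 1)‖ *
        sw t h (δ + Finsupp.single j 1 : Fin n →₀ ℕ)) := by ring
    _ ≤ t * N * m := by
        gcongr
        exact hmax _

lemma coeff_X_pderiv {n : ℕ} (u : MvPolynomial (Fin n) ℂ) (j : Fin n) (α : Fin n →₀ ℕ) :
    (MvPolynomial.X j * MvPolynomial.pderiv j u).coeff α = (α j : ℂ) * u.coeff α := by
  classical
  rw [MvPolynomial.coeff_X_mul']
  split_ifs with hs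
  · have h0 := Finsupp.mem_support_iff.mp hs
    rw [MvPolynomial.coeff_pderiv, tsub_add_cancel_of_le]
    · simp only [Finsupp.tsub_apply, Finsupp.single_eq_same]
      rw [Nat.cast_sub (by omega)]
      push_cast
      ring
    · rw [Finsupp.single_le_iff]
      omega
  · have : α j = 0 := by simpa using hs
    simp [this]

lemma coeff_resolvent {n : ℕ} (lam γ : Fin n → ℂ) (h : ℝ) (z : ℂ) (u : MvPolynomial (Fin n) ℂ)
    (α : Fin n →₀ ℕ) :
    (MvPolynomial.C z * u - qOp n lam γ h u).coeff α =
      (z - (h : ℂ) / Complex.I * ∑ j, lam j * (2 * (α j : ℂ) + 1)) * u.coeff α -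
      (h : ℂ) / Complex.I * ∑ j : Fin n, if hj : (j : ℕ) + 1 < n then
        γ j * (MvPolynomial.X (⟨(j : ℕ) + 1, hj⟩ : Fin n) * MvPolynomial.pderiv j u).coeff α
        else 0 := by
  unfold qOp
  rw [MvPolynomial.coeff_sub, MvPolynomial.coeff_C_mul, MvPolynomial.coeff_C_mul,
    MvPolynomial.coeff_add, MvPolynomial.coeff_add, MvPolynomial.coeff_sum,
    MvPolynomial.coeff_sum, MvPolynomial.coeff_C_mul]
  have e1 : ∑ j, MvPolynomial.coeff α (MvPolynomial.C (2 * lam j) * MvPolynomial.X j *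
      MvPolynomial.pderiv j u) = (∑ j, lam j * (2 * (α j : ℂ))) * u.coeff α := by
    rw [Finset.sum_mul]
    refine Finset.sum_congr rfl fun j _ => ?_
    rw [mul_assoc, MvPolynomial.coeff_C_mul, coeff_X_pderiv]
    ring
  have e2 : ∀ j : Fin n, MvPolynomial.coeff α (if hj : (j : ℕ) + 1 < n then
            MvPolynomial.C (γ j) * MvPolynomial.X (⟨(j : ℕ) + 1, hj⟩ : Fin n)
              * MvPolynomial.pderiv j u
          else 0) = if hj : (j : ℕ) + 1 < n then
        γ j * (MvPolynomial.X (⟨(j : ℕ) + 1, hj⟩ : Fin n) * MvPolynomial.pderiv j u).coeff α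
        else 0 := by
    intro j
    split_ifs
    · rw [mul_assoc, MvPolynomial.coeff_C_mul]
    · simp
  rw [e1, Finset.sum_congr rfl fun j _ => e2 j]
  simp_rw [mul_add, Finset.sum_add_distrib, mul_one]
  ring

lemma support_card {n N : ℕ} {u : MvPolynomial (Fin n) ℂ} (hu : u.totalDegree < N) :
    u.support.card ≤ N ^ n := by
  classical
  have : u.support.card ≤ (Fintype.piFinset fun _ : Fin n => Finset.range N).card := by
    apply Finset.card_le_card_of_injOn (fun α : Fin n →₀ ℕ => (α : Fin n → ℕ))
    · intro α hα
      have hd := deg_lt hu (MvPolynomial.mem_support_iff.mp hα)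
      simp only [Finset.mem_coe, Fintype.mem_piFinset, Finset.mem_range]
      intro i
      have := Finset.single_le_sum (f := fun i => α i) (fun _ _ => Nat.zero_le _)
        (Finset.mem_univ i)
      omega
    · intro a _ b _ hab
      exact DFunLike.coe_injective hab
  simpa using this

/-- The weighted sum of squares of coefficients. -/
noncomputable def gsum {n : ℕ} (h : ℝ) (u : MvPolynomial (Fin n) ℂ) : ℝ :=
  ∑ α ∈ u.support, ‖u.coeff α‖ ^ 2 * fw h α

lemma shift_sum_bound {n N : ℕ} (γ : Fin n → ℂ) (hγ : ∀ j, γ j = 0 ∨ γ j = 1)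
    {t h m : ℝ} (ht : 0 < t) (hh : 0 < h) (hm0 : 0 ≤ m)
    {u : MvPolynomial (Fin n) ℂ} (hu : u.totalDegree < N)
    (hmax : ∀ β : Fin n →₀ ℕ, ‖u.coeff β‖ * sw t h β ≤ m) (α : Fin n →₀ ℕ) :
    ‖∑ j : Fin n, if hj : (j : ℕ) + 1 < n then
        γ j * (MvPolynomial.X (⟨(j : ℕ) + 1, hj⟩ : Fin n) * MvPolynomial.pderiv j u).coeff α
        else 0‖ * sw t h α ≤ n * (t * N * m) := by
  have hs := (sw_pos ht hh (α : Fin n → ℕ)).le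
  refine (mul_le_mul_of_nonneg_right (norm_sum_le _ _) hs).trans ?_
  rw [Finset.sum_mul]
  have : ∑ j : Fin n, t * N * m = n * (t * N * m) := by simp
  rw [← this]
  refine Finset.sum_le_sum fun j _ => ?_
  split_ifs with hj
  · have hb := shift_bound ht hh hm0 hu hmax j ⟨j + 1, hj⟩ rfl α
    rcases hγ j with h0 | h1
    · rw [h0]
      simp only [zero_mul, norm_zero]
      positivity
    · rw [h1, one_mul]
      exact hb
  · simp only [zero_mul, norm_zero]
    positivity

lemma main_est {n : ℕ} (lam γ : Fin n → ℂ) (hγ : ∀ j, γ j = 0 ∨ γ j = 1)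
    {M₀ C t h : ℝ} (hM₀ : 0 < M₀) (hC : 0 < C) (ht : 0 < t) (ht1 : t ≤ 1)
    (htM : n * t * M₀ ≤ 1 / (2 * C)) (hh : 0 < h) {N : ℕ} (hN : (N : ℝ) * h ≤ M₀)
    {z : ℂ} (hz : 1 / C ≤ Metric.infDist z (specQ n lam h))
    {u : MvPolynomial (Fin n) ℂ} (hu : u.totalDegree < N) :
    gsum h u ≤ (N ^ n * (t⁻¹ ^ (n * N)) * (2 * C)) ^ 2 *
      gsum h (MvPolynomial.C z * u - qOp n lam γ h u) := by
  have hc' := coeff_resolvent lam γ h z u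
  set f := MvPolynomial.C z * u - qOp n lam γ h u with hf
  clear_value f
  unfold gsum
  have hfnn : ∀ α ∈ f.support, 0 ≤ ‖f.coeff α‖ ^ 2 * fw h α :=
    fun α _ => mul_nonneg (by positivity) (fw_pos hh _).le
  rcases u.support.eq_empty_or_nonempty with he | hne
  · rw [he, Finset.sum_empty]
    exact mul_nonneg (by positivity) (Finset.sum_nonneg hfnn)
  obtain ⟨α, hα, hmax'⟩ := Finset.exists_max_image u.support
    (fun β => ‖u.coeff β‖ * sw t h β) hne
  set m := ‖u.coeff α‖ * sw t h α with hm
  have hm0 : 0 ≤ m := mul_nonneg (norm_nonneg _) (sw_pos ht hh _).le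
  have hmax : ∀ β : Fin n →₀ ℕ, ‖u.coeff β‖ * sw t h β ≤ m := by
    intro β
    by_cases hb : β ∈ u.support
    · exact hmax' β hb
    · rw [MvPolynomial.notMem_support_iff.mp hb]
      simpa using hm0
  have hs := sw_pos ht hh (α : Fin n → ℕ)
  -- main lower bound
  have hlow : m ≤ 2 * C * (‖f.coeff α‖ * sw t h α) := by
    have hc := hc' α
    have hSb := shift_sum_bound γ hγ ht hh hm0 hu hmax α
    set μ := (h : ℂ) / Complex.I * ∑ j, lam j * (2 * (α j : ℂ) + 1) with hμ
    generalize (∑ j : Fin n, if hj : (j : ℕ) + 1 < n then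
        γ j * (MvPolynomial.X (⟨(j : ℕ) + 1, hj⟩ : Fin n) * MvPolynomial.pderiv j u).coeff α
        else 0) = S at hc hSb
    have hd : 1 / C ≤ ‖z - μ‖ := by
      rw [← dist_eq_norm]
      exact hz.trans (Metric.infDist_le_dist_of_mem ⟨α, hμ⟩)
    have hhn : ‖(h : ℂ) / Complex.I‖ = h := by
      rw [norm_div, Complex.norm_I, div_one, Complex.norm_real, Real.norm_of_nonneg hh.le]
    have h3 : ‖z - μ‖ * ‖u.coeff α‖ ≤ ‖f.coeff α‖ + h * ‖S‖ := by
      have e : h * ‖S‖ = ‖(h : ℂ) / Complex.I * S‖ := by rw [norm_mul, hhn]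
      rw [← norm_mul, e]
      calc _ = ‖f.coeff α + (h : ℂ) / Complex.I * S‖ := by rw [hc]; congr 1; ring
        _ ≤ _ := norm_add_le _ _
    have h4 : 1 / C * m ≤ ‖f.coeff α‖ * sw t h α + 1 / (2 * C) * m := by
      calc 1 / C * m ≤ ‖z - μ‖ * m := by gcongr
        _ = ‖z - μ‖ * ‖u.coeff α‖ * sw t h α := by rw [hm]; ring
        _ ≤ (‖f.coeff α‖ + h * ‖S‖) * sw t h α := by gcongr
        _ = ‖f.coeff α‖ * sw t h α + h * (‖S‖ * sw t h α) := by ring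
        _ ≤ ‖f.coeff α‖ * sw t h α + h * (n * (t * N * m)) := by gcongr
        _ = ‖f.coeff α‖ * sw t h α + n * t * (N * h) * m := by ring
        _ ≤ ‖f.coeff α‖ * sw t h α + n * t * M₀ * m := by gcongr
        _ ≤ _ := by gcongr
    have h5 : 1 / C * m = 1 / (2 * C) * m + 1 / (2 * C) * m := by field_simp; ring
    have h6 : 1 / (2 * C) * m ≤ ‖f.coeff α‖ * sw t h α := by linarith
    calc m = 2 * C * (1 / (2 * C) * m) := by field_simp
      _ ≤ _ := by gcongr
  have hfα : ‖f.coeff α‖ ^ 2 * fw h α ≤ ∑ α ∈ f.support, ‖f.coeff α‖ ^ 2 * fw h α := by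
    by_cases hb : α ∈ f.support
    · exact Finset.single_le_sum hfnn hb
    · rw [MvPolynomial.notMem_support_iff.mp hb]
      simpa using Finset.sum_nonneg hfnn
  have hm2 : m ^ 2 ≤ (2 * C) ^ 2 * ∑ α ∈ f.support, ‖f.coeff α‖ ^ 2 * fw h α := by
    have hw1 : t ^ wt (α : Fin n → ℕ) ≤ 1 := pow_le_one₀ ht.le ht1
    have hsw : sw t h (α : Fin n → ℕ) ≤ Real.sqrt (fw h α) := by
      unfold sw
      exact mul_le_of_le_one_left (Real.sqrt_nonneg _) hw1
    calc m ^ 2 ≤ (2 * C * (‖f.coeff α‖ * Real.sqrt (fw h α))) ^ 2 := by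
          apply pow_le_pow_left₀ hm0
          exact hlow.trans (by gcongr)
      _ = (2 * C) ^ 2 * (‖f.coeff α‖ ^ 2 * fw h α) := by
          rw [mul_pow, mul_pow ‖f.coeff α‖, Real.sq_sqrt (fw_pos hh _).le]
      _ ≤ _ := by gcongr
  have hterm : ∀ β ∈ u.support, ‖u.coeff β‖ ^ 2 * fw h β ≤ (t⁻¹ ^ (n * N)) ^ 2 * m ^ 2 := by
    intro β hβ
    have hdeg := deg_lt hu (MvPolynomial.mem_support_iff.mp hβ)
    have hw : wt (β : Fin n → ℕ) ≤ n * N := by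
      calc wt (β : Fin n → ℕ) ≤ ∑ j, n * β j := by
            unfold wt
            exact Finset.sum_le_sum fun j _ => Nat.mul_le_mul_right _ j.2.le
        _ = n * ∑ j, β j := (Finset.mul_sum _ _ _).symm
        _ ≤ n * N := Nat.mul_le_mul_left _ hdeg.le
    have h1 : Real.sqrt (fw h β) ≤ t⁻¹ ^ (n * N) * sw t h β := by
      unfold sw
      rw [← mul_assoc]
      apply le_mul_of_one_le_left (Real.sqrt_nonneg _)
      rw [inv_pow, inv_mul_eq_div, one_le_div (by positivity)]
      exact pow_le_pow_of_le_one ht.le ht1 hw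
    calc ‖u.coeff β‖ ^ 2 * fw h β = (‖u.coeff β‖ * Real.sqrt (fw h β)) ^ 2 := by
          rw [mul_pow, Real.sq_sqrt (fw_pos hh _).le]
      _ ≤ (t⁻¹ ^ (n * N) * m) ^ 2 := by
          apply pow_le_pow_left₀ (by positivity)
          calc _ ≤ ‖u.coeff β‖ * (t⁻¹ ^ (n * N) * sw t h β) := by gcongr
            _ = t⁻¹ ^ (n * N) * (‖u.coeff β‖ * sw t h β) := by ring
            _ ≤ _ := by
              gcongr
              exact hmax β
      _ = _ := by ring
  have hcard : (u.support.card : ℝ) ≤ (N ^ n : ℝ) ^ 2 := by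
    have h1 : (u.support.card : ℝ) ≤ (N : ℝ) ^ n := by exact_mod_cast support_card hu
    have h2 : (1 : ℝ) ≤ (N : ℝ) ^ n := by
      apply one_le_pow₀
      have : 1 ≤ N := by omega
      exact_mod_cast this
    nlinarith
  calc _ ≤ u.support.card • ((t⁻¹ ^ (n * N)) ^ 2 * m ^ 2) := Finset.sum_le_card_nsmul _ _ _ hterm
    _ = u.support.card * ((t⁻¹ ^ (n * N)) ^ 2 * m ^ 2) := nsmul_eq_mul _ _
    _ ≤ (N ^ n : ℝ) ^ 2 * ((t⁻¹ ^ (n * N)) ^ 2 *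
        ((2 * C) ^ 2 * ∑ α ∈ f.support, ‖f.coeff α‖ ^ 2 * fw h α)) := by gcongr
    _ = _ := by ring

/-- For all `M₀ > 0`, `C > 0` there are `A > 0`, `h₀ > 0` such that for all
`h ∈ (0,h₀]`, all integers `N ≥ 1` with `Nh ≤ M₀`, all `z` with
`dist(z, {μ_α}) ≥ 1/C`, and every polynomial `u` of degree `< N`,
`‖u‖_{H_Φ} ≤ A e^{A/h} ‖(z − Q_h)u‖_{H_Φ}`. -/
theorem statement_14 {n : ℕ} (lam : Fin n → ℂ) (hlam : ∀ j, 0 < (lam j).im)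
    (γ : Fin n → ℂ) (hγ : ∀ j, γ j = 0 ∨ γ j = 1)
    (M₀ C : ℝ) (hM₀ : 0 < M₀) (hC : 0 < C) :
    ∃ A > 0, ∃ h₀ > 0, ∀ h : ℝ, 0 < h → h ≤ h₀ →
      ∀ N : ℕ, 1 ≤ N → (N : ℝ) * h ≤ M₀ →
      ∀ z : ℂ, 1 / C ≤ Metric.infDist z (specQ n lam h) →
      ∀ u : MvPolynomial (Fin n) ℂ, u.totalDegree < N →
        hPhiNorm h (evalPoly u) ≤
          A * Real.exp (A / h) *
            hPhiNorm h (evalPoly (MvPolynomial.C z * u - qOp n lam γ h u)) := by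
  set t : ℝ := 1 / (2 * n * M₀ * C + 1) with ht
  have hD : (1 : ℝ) ≤ 2 * n * M₀ * C + 1 := by
    have : 0 ≤ 2 * n * M₀ * C := by positivity
    linarith
  have ht0 : 0 < t := by positivity
  have ht1 : t ≤ 1 := by
    rw [ht, div_le_one (by linarith)]
    exact hD
  have htM : n * t * M₀ ≤ 1 / (2 * C) := by
    rw [ht, mul_one_div, div_mul_eq_mul_div, div_le_div_iff₀ (by linarith) (by positivity)]
    linarith
  set L := Real.log t⁻¹ with hL
  have hL0 : 0 ≤ L := Real.log_nonneg ((one_le_inv₀ ht0).mpr ht1)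
  have hB0 : 0 ≤ n * (1 + L) * M₀ := by positivity
  refine ⟨2 * C + n * (1 + L) * M₀, by positivity, 1, one_pos, ?_⟩
  intro h hh _ N hN hNM z hz u hu
  have key := main_est lam γ hγ hM₀ hC ht0 ht1 htM hh hNM hz hu
  unfold gsum at key
  unfold hPhiNorm
  rw [hPhi_sq hh, hPhi_sq hh]
  have hK : (0 : ℝ) ≤ N ^ n * (t⁻¹ ^ (n * N)) * (2 * C) := by positivity
  refine (Real.sqrt_le_sqrt key).trans ?_
  rw [Real.sqrt_mul (sq_nonneg _), Real.sqrt_sq hK]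
  refine mul_le_mul_of_nonneg_right ?_ (Real.sqrt_nonneg _)
  have hNe : (N : ℝ) ^ n ≤ Real.exp (n * N) := by
    rw [Real.exp_nat_mul]
    apply pow_le_pow_left₀ (Nat.cast_nonneg N)
    have := Real.add_one_le_exp (N : ℝ)
    linarith
  have hte : t⁻¹ ^ (n * N) = Real.exp (n * N * L) := by
    rw [← Nat.cast_mul, Real.exp_nat_mul, hL, Real.exp_log (by positivity)]
  have hNh : (N : ℝ) ≤ M₀ / h := by
    rw [le_div_iff₀ hh]
    exact hNM
  calc (N : ℝ) ^ n * (t⁻¹ ^ (n * N)) * (2 * C)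
      ≤ Real.exp (n * N) * Real.exp (n * N * L) * (2 * C) := by rw [hte]; gcongr
    _ = 2 * C * Real.exp (n * (1 + L) * N) := by
        rw [← Real.exp_add, mul_comm]
        congr 2
        ring
    _ ≤ (2 * C + n * (1 + L) * M₀) * Real.exp ((2 * C + n * (1 + L) * M₀) / h) := by
        have : n * (1 + L) * N ≤ (2 * C + n * (1 + L) * M₀) / h := by
          calc n * (1 + L) * N ≤ n * (1 + L) * (M₀ / h) := by gcongr
            _ = n * (1 + L) * M₀ / h := by ring
            _ ≤ _ := by
              gcongr
              linarith
        gcongr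
        linarith
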